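/- Let G be a finite Q(P4)-free graph, q: V(G) → ℕ a vertex-weight function that is positive on at least one vertex, and f: ℕ>0 → ℕ>0 a superadditive function (f(s1) + f(s2) ≤ f(s1 + s2) for all s1, s2 ≥ 1). If χ_{q'}(G) ≤ f(ω_{q'}(G)) holds for every ⊲-minimal vertex-weight function q': V(G) → ℕ (positive somewhere) for which the subgraph G[q'] induced by the vertices of positive q'-weight is prime and has no clique-separator of modules, then χ_q(G) ≤ f(ω_q(G)). -/

import Mathlib

open SimpleGraph

/-- `G` is `H`-free: no induced subgraph of `G` is isomorphic to `H`. -/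
def IndFree {α β : Type*} (H : SimpleGraph α) (G : SimpleGraph β) : Prop :=
  ∀ s : Set β, ¬ Nonempty (H ≃g G.induce s)

/-- The banner: a 4-cycle `0-1-2-3-0` together with a pendant vertex `4` adjacent to `0`. -/
def banner : SimpleGraph (Fin 5) :=
  SimpleGraph.fromEdgeSet {s(0,1), s(1,2), s(2,3), s(3,0), s(0,4)}

/-- The co-banner: the complement of the banner. -/
def coBanner : SimpleGraph (Fin 5) := bannerᶜ

/-- `2K₂`: the disjoint union of two edges. -/
def twoK2 : SimpleGraph (Fin 4) := SimpleGraph.fromEdgeSet {s(0,1), s(2,3)}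

/-- `3K₁`: three pairwise nonadjacent vertices. -/
def threeK1 : SimpleGraph (Fin 3) := ⊥

/-- The 5-wheel: a 5-cycle `0-1-2-3-4-0` plus a hub `5` adjacent to all cycle vertices. -/
def wheel5 : SimpleGraph (Fin 6) :=
  SimpleGraph.fromEdgeSet
    {s(0,1), s(1,2), s(2,3), s(3,4), s(4,0), s(5,0), s(5,1), s(5,2), s(5,3), s(5,4)}

/-- A nonempty set `M` is a module if every vertex outside `M` is adjacent to all
or to none of the vertices of `M`. -/
def IsModule {V : Type*} (G : SimpleGraph V) (M : Set V) : Prop :=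
  M.Nonempty ∧ ∀ v ∉ M, (∀ u ∈ M, G.Adj v u) ∨ (∀ u ∈ M, ¬ G.Adj v u)

/-- `X` is a clique-separator of modules in `G`. -/
def IsCliqueSeparatorOfModules {V : Type*} (G : SimpleGraph V) (X : Set V) : Prop :=
  (∃ (k : ℕ) (Xs : Fin k → Set V),
      (∀ i, IsModule G (Xs i)) ∧
      (∀ i j, i ≠ j → Disjoint (Xs i) (Xs j)) ∧
      (∀ i j, i ≠ j → ∀ u ∈ Xs i, ∀ v ∈ Xs j, G.Adj u v) ∧
      X = ⋃ i, Xs i) ∧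
  (∃ A B : Set V, A ∪ B = Set.univ ∧ (A \ B).Nonempty ∧ (B \ A).Nonempty ∧
      (∀ a ∈ A \ B, ∀ b ∈ B \ A, ¬ G.Adj a b) ∧ A ∩ B = X)

/-- A graph is prime if it has no homogeneous set,
i.e. no module `M` with `1 < |M| < |V(G)|`. -/
def IsPrime {V : Type*} (G : SimpleGraph V) : Prop :=
  ¬ ∃ M : Set V, IsModule G M ∧ 1 < M.ncard ∧ M.ncard < Nat.card V

/-- A nonempty graph is critical if deleting any vertex decreases the chromatic number. -/
def IsCritical {V : Type*} (G : SimpleGraph V) : Prop :=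
  Nonempty V ∧ ∀ v : V, (G.induce {u | u ≠ v}).chromaticNumber < G.chromaticNumber

/-- `G` is a `non-empty, 2K₁-free'-expansion of `G'`: the fibres of `f` partition `V(G)`
into nonempty cliques, with complete/empty bipartite connections according to `G'`. -/
def IsExpansionOf {V W : Type*} (G : SimpleGraph V) (G' : SimpleGraph W) : Prop :=
  ∃ f : V → W, Function.Surjective f ∧
    (∀ u v, u ≠ v → f u = f v → G.Adj u v) ∧
    (∀ u v, f u ≠ f v → (G.Adj u v ↔ G'.Adj (f u) (f v)))

/-- The weighted chromatic number `χ_q(G)`: the least `k` such that every vertex `v`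
can be assigned a set of `q v` colours from `{1,…,k}` with disjoint sets on adjacent
vertices. -/
noncomputable def wChromaticNumber {V : Type*} (G : SimpleGraph V) (q : V → ℕ) : ℕ :=
  sInf {k | ∃ L : V → Finset (Fin k), (∀ v, (L v).card = q v) ∧
    ∀ ⦃u v⦄, G.Adj u v → Disjoint (L u) (L v)}

/-- The weighted clique number `ω_q(G)`: the maximum total weight of a clique. -/
noncomputable def wCliqueNum {V : Type*} (G : SimpleGraph V) (q : V → ℕ) : ℕ :=
  sSup {m | ∃ s : Finset V, G.IsClique (s : Set V) ∧ m = ∑ v ∈ s, q v}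

/-- `Q(F)`: a path `u₁u₂u₃u₄` whose third vertex `u₃` has been replaced by a copy of `F`,
each of whose vertices is adjacent to both `u₂` and `u₄`. Here `inr 0 = u₁`, `inr 1 = u₂`,
`inr 2 = u₄`, and `inl w` are the vertices of the copy of `F`. -/
def QGraph {W : Type*} (F : SimpleGraph W) : SimpleGraph (W ⊕ Fin 3) :=
  SimpleGraph.fromRel (fun a b =>
    (∃ w w', a = Sum.inl w ∧ b = Sum.inl w' ∧ F.Adj w w') ∨
    (a = Sum.inr 0 ∧ b = Sum.inr 1) ∨
    (∃ w, a = Sum.inl w ∧ (b = Sum.inr 1 ∨ b = Sum.inr 2)))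

/-- The join of two graphs: all edges of both graphs plus all edges in between. -/
def joinGraph {α β : Type*} (G₁ : SimpleGraph α) (G₂ : SimpleGraph β) :
    SimpleGraph (α ⊕ β) :=
  SimpleGraph.fromRel (fun a b =>
    (∃ u v, a = Sum.inl u ∧ b = Sum.inl v ∧ G₁.Adj u v) ∨
    (∃ u v, a = Sum.inr u ∧ b = Sum.inr v ∧ G₂.Adj u v) ∨
    (∃ u v, a = Sum.inl u ∧ b = Sum.inr v))

/-- `H` has a spanning complete bipartite subgraph. -/
def HasSpanningCompleteBipartite {α : Type*} (H : SimpleGraph α) : Prop :=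
  ∃ A B : Set α, A.Nonempty ∧ B.Nonempty ∧ Disjoint A B ∧ A ∪ B = Set.univ ∧
    ∀ a ∈ A, ∀ b ∈ B, H.Adj a b

/-- `G'` is a `q`-expansion of `G`: each vertex `u` of `G` is replaced by a clique on
`q u` vertices, joined completely or not at all according to adjacency in `G`. -/
def IsWeightedExpansion {V' V : Type*} (G' : SimpleGraph V') (G : SimpleGraph V)
    (q : V → ℕ) : Prop :=
  ∃ f : V' → V,
    (∀ v : V, Nat.card (f ⁻¹' {v}) = q v) ∧
    (∀ a b : V', a ≠ b → f a = f b → G'.Adj a b) ∧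
    (∀ a b : V', f a ≠ f b → (G'.Adj a b ↔ G.Adj (f a) (f b)))

/-- `q` is `⊲`-minimal: no weight function pointwise at most `q` with strictly smaller
total weight has the same weighted chromatic number. -/
def IsTriMinimal {V : Type*} [Fintype V] (G : SimpleGraph V) (q : V → ℕ) : Prop :=
  ¬ ∃ q' : V → ℕ, (∀ v, q' v ≤ q v) ∧ (∑ v, q' v) < (∑ v, q v) ∧
      wChromaticNumber G q' = wChromaticNumber G q


section Colouring

variable {V : Type*}

/-- A proper assignment of colour sets `L` with `q v` colours at each vertex `v`. -/
def IsWeightedColoring (G : SimpleGraph V) (q : V → ℕ) {α : Type*} (L : V → Finset α) : Prop :=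
  (∀ v, (L v).card = q v) ∧ ∀ ⦃u v⦄, G.Adj u v → Disjoint (L u) (L v)

theorem IsWeightedColoring.map {G : SimpleGraph V} {q : V → ℕ} {α β : Type*}
    {L : V → Finset α} (h : IsWeightedColoring G q L) (e : α ↪ β) :
    IsWeightedColoring G q fun v => (L v).map e :=
  ⟨fun v => by simpa using h.1 v, fun u v huv => (Finset.disjoint_map e).2 (h.2 huv)⟩

theorem wChromaticNumber_le_card {G : SimpleGraph V} {q : V → ℕ} {α : Type*} [Fintype α]
    {L : V → Finset α} (h : IsWeightedColoring G q L) :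
    wChromaticNumber G q ≤ Fintype.card α :=
  Nat.sInf_le ⟨_, h.map (Fintype.equivFin α).toEmbedding⟩

theorem exists_isWeightedColoring [Finite V] (G : SimpleGraph V) (q : V → ℕ) :
    ∃ L : V → Finset (Fin (wChromaticNumber G q)), IsWeightedColoring G q L := by
  have := Fintype.ofFinite V
  have key : IsWeightedColoring G q
      fun v => (Finset.univ : Finset (Fin (q v))).map
        (Function.Embedding.sigmaMk (β := fun v => Fin (q v)) v) := by
    refine ⟨fun v => by simp, fun u v huv => Finset.disjoint_left.2 ?_⟩
    simp only [Finset.mem_map, Finset.mem_univ, true_and, not_exists,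
      Function.Embedding.sigmaMk_apply]
    rintro _ ⟨i, rfl⟩ j h
    exact huv.ne (congrArg Sigma.fst h).symm
  exact Nat.sInf_mem (s := {k | ∃ L : V → Finset (Fin k), IsWeightedColoring G q L})
    ⟨_, _, key.map (Fintype.equivFin _).toEmbedding⟩

theorem exists_isWeightedColoring_of_le [Finite V] {G : SimpleGraph V} {q : V → ℕ} {k : ℕ}
    (hk : wChromaticNumber G q ≤ k) :
    ∃ L : V → Finset (Fin k), IsWeightedColoring G q L :=
  let ⟨_, hL⟩ := exists_isWeightedColoring G q
  ⟨_, hL.map (Fin.castLEEmb hk)⟩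

/-- A weighted colouring can be rearranged so that, on a join of modules, each module is coloured
by a copy of a prescribed optimal colouring. -/
theorem IsWeightedColoring.exists_normalized [Fintype V] {G : SimpleGraph V} {p q : V → ℕ}
    {α ι : Type*} {L : V → Finset α} (hL : IsWeightedColoring G p L)
    {X : Set V} {c : V → ι} (hp : ∀ v ∈ X, p v = q v)
    (hjoin : ∀ u ∈ X, ∀ v ∈ X, c u ≠ c v → G.Adj u v)
    (hmod : ∀ u ∈ X, ∀ v ∈ X, c u = c v → ∀ w, 0 < p w → w ∉ X → (G.Adj u w ↔ G.Adj v w))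
    {m : ι → ℕ} (hm : ∀ i, m i = wChromaticNumber G ({v | v ∈ X ∧ c v = i}.indicator q))
    {K : ∀ i, V → Finset (Fin (m i))}
    (hK : ∀ i, IsWeightedColoring G ({v | v ∈ X ∧ c v = i}.indicator q) (K i)) :
    ∃ (j : (Σ i, Fin (m i)) ↪ α) (L' : V → Finset α), IsWeightedColoring G p L' ∧
      ∀ v ∈ X, L' v = (K (c v) v).map ((Function.Embedding.sigmaMk (c v)).trans j) := by
  classical
  let U : ι → Finset α := fun i => (Finset.univ.filter fun v => v ∈ X ∧ c v = i).biUnion L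
  have hU : ∀ i x, x ∈ U i ↔ ∃ v, (v ∈ X ∧ c v = i) ∧ x ∈ L v := by simp [U]
  have hmU : ∀ i, m i ≤ (U i).card := by
    intro i
    rw [hm, ← Fintype.card_coe]
    refine wChromaticNumber_le_card
      (L := fun v => if v ∈ X ∧ c v = i then (L v).subtype (· ∈ U i) else ∅) ⟨fun v => ?_, ?_⟩
    · dsimp only
      by_cases hv : v ∈ X ∧ c v = i
      · rw [if_pos hv, Set.indicator_of_mem (by exact hv), ← hp v hv.1, ← hL.1 v,
          Finset.card_subtype, Finset.filter_true_of_mem]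
        exact fun x hx => (hU i x).2 ⟨v, hv, hx⟩
      · rw [if_neg hv, Set.indicator_of_notMem (by exact hv), Finset.card_empty]
    · intro u v huv
      dsimp only
      split_ifs
      · rw [Finset.disjoint_left]
        intro x hx hx'
        rw [Finset.mem_subtype] at hx hx'
        exact Finset.disjoint_left.1 (hL.2 huv) hx hx'
      all_goals simp
  have hh : ∀ i, ∃ h : Fin (m i) ↪ α, ∀ x, h x ∈ U i := by
    intro i
    obtain ⟨e⟩ : Nonempty (Fin (m i) ↪ U i) :=
      Function.Embedding.nonempty_of_card_le (by simpa using hmU i)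
    exact ⟨e.trans (Function.Embedding.subtype _), fun x => (e x).2⟩
  choose h hhU using hh
  have hUdisj : ∀ i i' x, x ∈ U i → x ∈ U i' → i = i' := by
    intro i i' x hx hx'
    obtain ⟨u, ⟨hu, rfl⟩, hxu⟩ := (hU _ _).1 hx
    obtain ⟨v, ⟨hv, rfl⟩, hxv⟩ := (hU _ _).1 hx'
    by_contra hne
    exact Finset.disjoint_left.1 (hL.2 (hjoin u hu v hv hne)) hxu hxv
  let j : (Σ i, Fin (m i)) ↪ α := ⟨fun x => h x.1 x.2, by
    rintro ⟨i, x⟩ ⟨i', x'⟩ hxx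
    dsimp only at hxx
    obtain rfl := hUdisj i i' _ (hhU i x) (hxx ▸ hhU i' x')
    rw [(h i).injective hxx]⟩
  have hjU : ∀ v x, x ∈ (K (c v) v).map ((Function.Embedding.sigmaMk (c v)).trans j) →
      x ∈ U (c v) := by
    intro v x hx
    obtain ⟨y, -, rfl⟩ := Finset.mem_map.1 hx
    exact hhU _ y
  have hout : ∀ u v, G.Adj u v → u ∈ X → v ∉ X →
      Disjoint ((K (c u) u).map ((Function.Embedding.sigmaMk (c u)).trans j)) (L v) := by
    intro u v huv hu hv
    rw [Finset.disjoint_left]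
    intro x hx hxv
    obtain ⟨w, ⟨hw, hwc⟩, hxw⟩ := (hU _ _).1 (hjU u x hx)
    have hpv : 0 < p v := hL.1 v ▸ Finset.card_pos.2 ⟨x, hxv⟩
    exact Finset.disjoint_left.1 (hL.2 ((hmod u hu w hw hwc.symm v hpv hv).1 huv)) hxw hxv
  refine ⟨j, fun v => if v ∈ X then
    (K (c v) v).map ((Function.Embedding.sigmaMk (c v)).trans j) else L v, ⟨fun v => ?_, ?_⟩,
    fun v hv => if_pos hv⟩
  · dsimp only
    split_ifs with hv
    · rw [Finset.card_map, (hK _).1, Set.indicator_of_mem (by exact ⟨hv, rfl⟩), hp v hv]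
    · exact hL.1 v
  · intro u v huv
    dsimp only
    split_ifs with hu hv hv
    · by_cases hc : c u = c v
      · rw [← hc]
        exact (Finset.disjoint_map _).2 ((hK _).2 huv)
      · rw [Finset.disjoint_left]
        exact fun x hx hx' => hc (hUdisj _ _ x (hjU u x hx) (hjU v x hx'))
    · exact hout u v huv hu hv
    · exact (hout v u huv.symm hv hu).symm
    · exact hL.2 huv

theorem Function.Embedding.exists_perm_comp_eq {α β : Type*} [Finite β] (i j : α ↪ β) :
    ∃ σ : Equiv.Perm β, ∀ x, σ (i x) = j x := by
  classical
  have := Fintype.ofFinite β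
  let e := (Equiv.ofInjective i i.injective).symm.trans (Equiv.ofInjective j j.injective)
  refine ⟨e.extendSubtype, fun x => ?_⟩
  rw [Equiv.extendSubtype_apply_of_mem e (i x) ⟨x, rfl⟩]
  simp [e]

/-- Gluing colourings along a join of modules that separates the graph. -/
theorem wChromaticNumber_le_max_of_separator [Fintype V] {G : SimpleGraph V} {q : V → ℕ}
    {ι : Type*} {A B : Set V} {c : V → ι}
    (hcover : ∀ v, 0 < q v → v ∈ A ∪ B)
    (hsep : ∀ a ∈ A \ B, ∀ b ∈ B \ A, ¬ G.Adj a b)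
    (hjoin : ∀ u ∈ A ∩ B, ∀ v ∈ A ∩ B, c u ≠ c v → G.Adj u v)
    (hmod : ∀ u ∈ A ∩ B, ∀ v ∈ A ∩ B, c u = c v → ∀ w, 0 < q w → w ∉ A ∩ B →
      (G.Adj u w ↔ G.Adj v w)) :
    wChromaticNumber G q ≤
      max (wChromaticNumber G (A.indicator q)) (wChromaticNumber G (B.indicator q)) := by
  classical
  have hpos : ∀ (C : Set V) w, 0 < C.indicator q w → 0 < q w := fun C w hw =>
    hw.trans_le (Set.indicator_le_self' (fun _ _ => Nat.zero_le _) w)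
  choose K hK using fun i =>
    exists_isWeightedColoring G ({v | v ∈ A ∩ B ∧ c v = i}.indicator q)
  obtain ⟨L₁, hL₁⟩ := exists_isWeightedColoring_of_le
    (le_max_left (wChromaticNumber G (A.indicator q)) (wChromaticNumber G (B.indicator q)))
  obtain ⟨L₂, hL₂⟩ := exists_isWeightedColoring_of_le
    (le_max_right (wChromaticNumber G (A.indicator q)) (wChromaticNumber G (B.indicator q)))
  obtain ⟨j₁, M₁, hM₁, hMK₁⟩ := hL₁.exists_normalized (X := A ∩ B) (c := c)
    (fun v hv => Set.indicator_of_mem hv.1 q) hjoin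
    (fun u hu v hv h w hw => hmod u hu v hv h w (hpos _ w hw)) (fun _ => rfl) hK
  obtain ⟨j₂, M₂, hM₂, hMK₂⟩ := hL₂.exists_normalized (X := A ∩ B) (c := c)
    (fun v hv => Set.indicator_of_mem hv.2 q) hjoin
    (fun u hu v hv h w hw => hmod u hu v hv h w (hpos _ w hw)) (fun _ => rfl) hK
  obtain ⟨σ, hσ⟩ := j₁.exists_perm_comp_eq j₂
  have hagree : ∀ v ∈ A ∩ B, (M₁ v).map σ.toEmbedding = M₂ v := by
    intro v hv
    rw [hMK₁ v hv, hMK₂ v hv, Finset.map_map]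
    congr 1
    ext x
    exact congrArg _ (hσ _)
  have hM₁' := hM₁.map σ.toEmbedding
  have hempty : ∀ v, v ∉ B → M₂ v = ∅ := fun v hv => by
    rw [← Finset.card_eq_zero, hM₂.1, Set.indicator_of_notMem hv]
  have hcross : ∀ u v, G.Adj u v → u ∈ A → v ∉ A →
      Disjoint ((M₁ u).map σ.toEmbedding) (M₂ v) := by
    intro u v huv hu hv
    by_cases hvB : v ∈ B
    · by_cases huB : u ∈ B
      · rw [hagree u ⟨hu, huB⟩]
        exact hM₂.2 huv
      · exact absurd huv (hsep u ⟨hu, huB⟩ v ⟨hvB, hv⟩)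
    · rw [hempty v hvB]
      exact Finset.disjoint_empty_right _
  have hfinal : IsWeightedColoring G q
      fun v => if v ∈ A then (M₁ v).map σ.toEmbedding else M₂ v := by
    refine ⟨fun v => ?_, fun u v huv => ?_⟩
    · dsimp only
      split_ifs with hv
      · rw [hM₁'.1, Set.indicator_of_mem hv]
      · rw [hM₂.1]
        by_cases hvB : v ∈ B
        · exact Set.indicator_of_mem hvB _
        · rw [Set.indicator_of_notMem hvB]
          by_contra hne
          exact (hcover v (by omega)).elim hv hvB
    · dsimp only
      split_ifs with hu hv hv
      · exact hM₁'.2 huv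
      · exact hcross u v huv hu hv
      · exact (hcross v u huv.symm hv hu).symm
      · exact hM₂.2 huv
  simpa using wChromaticNumber_le_card hfinal

/-- Colouring two parts covering the support with disjoint palettes. -/
theorem wChromaticNumber_le_add [Finite V] {G : SimpleGraph V} {q : V → ℕ} {A B : Set V}
    (hcover : ∀ v, 0 < q v → v ∈ A ∪ B) :
    wChromaticNumber G q ≤
      wChromaticNumber G (A.indicator q) + wChromaticNumber G (B.indicator q) := by
  classical
  obtain ⟨L₁, hL₁⟩ := exists_isWeightedColoring G (A.indicator q)
  obtain ⟨L₂, hL₂⟩ := exists_isWeightedColoring G (B.indicator q)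
  have hfinal : IsWeightedColoring G q fun v =>
      if v ∈ A then
        (L₁ v).map (Function.Embedding.inl (β := Fin (wChromaticNumber G (B.indicator q))))
      else (L₂ v).map Function.Embedding.inr := by
    refine ⟨fun v => ?_, fun u v huv => ?_⟩
    · dsimp only
      split_ifs with hv
      · rw [Finset.card_map, hL₁.1, Set.indicator_of_mem hv]
      · rw [Finset.card_map, hL₂.1]
        by_cases hvB : v ∈ B
        · exact Set.indicator_of_mem hvB _
        · rw [Set.indicator_of_notMem hvB]
          by_contra hne
          exact (hcover v (by omega)).elim hv hvB
    · dsimp only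
      split_ifs with hu hv hv
      · exact (Finset.disjoint_map _).2 (hL₁.2 huv)
      · simp [Finset.disjoint_left]
      · simp [Finset.disjoint_left]
      · exact (Finset.disjoint_map _).2 (hL₂.2 huv)
  simpa using wChromaticNumber_le_card hfinal

/-- A vertex dominated by a nonadjacent twin can be deleted. -/
theorem wChromaticNumber_le_update_zero [Finite V] [DecidableEq V] {G : SimpleGraph V}
    {q : V → ℕ} {u v : V} (huv : ¬ G.Adj u v) (hle : q v ≤ q u) (hne : u ≠ v)
    (htwin : ∀ w, 0 < q w → w ≠ u → w ≠ v → (G.Adj u w ↔ G.Adj v w)) :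
    wChromaticNumber G q ≤ wChromaticNumber G (Function.update q v 0) := by
  obtain ⟨L, hL⟩ := exists_isWeightedColoring G (Function.update q v 0)
  obtain ⟨T, hT, hTc⟩ := Finset.exists_subset_card_eq (s := L u) (n := q v)
    (by rwa [hL.1, Function.update_of_ne hne])
  have hcross : ∀ w, G.Adj v w → w ≠ v → Disjoint T (L w) := by
    intro w hvw hwv
    refine Finset.disjoint_of_subset_left hT ?_
    by_cases hw : 0 < q w
    · exact hL.2 ((htwin w hw (fun h => huv (h ▸ hvw).symm) hwv).2 hvw)
    · have : L w = ∅ := by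
        rw [← Finset.card_eq_zero, hL.1, Function.update_of_ne hwv]
        omega
      simp [this]
  have hfinal : IsWeightedColoring G q (Function.update L v T) := by
    refine ⟨fun w => ?_, fun a b hab => ?_⟩
    · rcases eq_or_ne w v with rfl | hw
      · simpa using hTc
      · rw [Function.update_of_ne hw, hL.1, Function.update_of_ne hw]
    · rcases eq_or_ne a v with rfl | ha
      · rw [Function.update_self, Function.update_of_ne hab.ne']
        exact hcross b hab hab.ne'
      · rcases eq_or_ne b v with rfl | hb
        · rw [Function.update_self, Function.update_of_ne ha]
          exact (hcross a hab.symm ha).symm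
        · rw [Function.update_of_ne ha, Function.update_of_ne hb]
          exact hL.2 hab
  simpa using wChromaticNumber_le_card hfinal

/-- The weight of a vertex can be moved to an adjacent twin. -/
theorem wChromaticNumber_le_merge [Finite V] [DecidableEq V] {G : SimpleGraph V}
    {q : V → ℕ} {u v : V} (hne : u ≠ v)
    (htwin : ∀ w, 0 < q w → w ≠ u → w ≠ v → (G.Adj u w ↔ G.Adj v w)) :
    wChromaticNumber G q ≤
      wChromaticNumber G (Function.update (Function.update q v 0) u (q u + q v)) := by
  obtain ⟨L, hL⟩ :=
    exists_isWeightedColoring G (Function.update (Function.update q v 0) u (q u + q v))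
  have hLu : (L u).card = q u + q v := by rw [hL.1, Function.update_self]
  obtain ⟨T, hT, hTc⟩ := Finset.exists_subset_card_eq (s := L u) (n := q v) (by omega)
  have hw : ∀ w, w ≠ u → w ≠ v → (L w).card = q w := fun w hu hv => by
    rw [hL.1, Function.update_of_ne hu, Function.update_of_ne hv]
  have hu : ∀ w, w ≠ u → w ≠ v → (G.Adj u w ∨ G.Adj v w) → Disjoint (L u) (L w) := by
    intro w hwu hwv hadj
    by_cases hq : 0 < q w
    · exact hL.2 (hadj.elim id (htwin w hq hwu hwv).2)
    · have : L w = ∅ := by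
        rw [← Finset.card_eq_zero, hw w hwu hwv]
        omega
      simp [this]
  have hfinal : IsWeightedColoring G q
      (Function.update (Function.update L v T) u (L u \ T)) := by
    have hLv : ∀ w, w ≠ u → w ≠ v →
        Function.update (Function.update L v T) u (L u \ T) w = L w := fun w hu hv => by
      rw [Function.update_of_ne hu, Function.update_of_ne hv]
    have hself : Function.update (Function.update L v T) u (L u \ T) u = L u \ T :=
      Function.update_self ..
    have hother : Function.update (Function.update L v T) u (L u \ T) v = T := by
      rw [Function.update_of_ne hne.symm, Function.update_self]
    have hsub : ∀ w, w = u ∨ w = v →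
        Function.update (Function.update L v T) u (L u \ T) w ⊆ L u := by
      rintro w (rfl | rfl)
      · rw [hself]
        exact Finset.sdiff_subset
      · rwa [hother]
    refine ⟨fun w => ?_, fun a b hab => ?_⟩
    · by_cases h1 : w = u
      · rw [h1, hself, Finset.card_sdiff_of_subset hT]
        omega
      · by_cases h2 : w = v
        · rw [h2, hother, hTc]
        · rw [hLv w h1 h2, hw w h1 h2]
    · by_cases ha : a = u ∨ a = v <;> by_cases hb : b = u ∨ b = v
      · rcases ha with rfl | rfl <;> rcases hb with rfl | rfl
        · exact absurd rfl hab.ne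
        · rw [hself, hother]
          exact Finset.sdiff_disjoint
        · rw [hself, hother]
          exact Finset.disjoint_sdiff
        · exact absurd rfl hab.ne
      · refine Finset.disjoint_of_subset_left (hsub a ha) ?_
        push Not at hb
        rw [hLv b hb.1 hb.2]
        rcases ha with rfl | rfl
        exacts [hu b hb.1 hb.2 (.inl hab), hu b hb.1 hb.2 (.inr hab)]
      · refine Finset.disjoint_of_subset_right (hsub b hb) ?_
        push Not at ha
        rw [hLv a ha.1 ha.2]
        rcases hb with rfl | rfl
        exacts [(hu a ha.1 ha.2 (.inl hab.symm)).symm, (hu a ha.1 ha.2 (.inr hab.symm)).symm]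
      · push Not at ha hb
        rw [hLv a ha.1 ha.2, hLv b hb.1 hb.2]
        exact hL.2 hab
  simpa using wChromaticNumber_le_card hfinal

end Colouring

section CliqueNumber

variable {V : Type*} [Fintype V] {G : SimpleGraph V} {q : V → ℕ}

theorem bddAbove_cliqueWeights (G : SimpleGraph V) (q : V → ℕ) :
    BddAbove {m | ∃ s : Finset V, G.IsClique (s : Set V) ∧ m = ∑ v ∈ s, q v} := by
  refine ⟨∑ v, q v, ?_⟩
  rintro _ ⟨s, -, rfl⟩
  exact Finset.sum_le_sum_of_subset (Finset.subset_univ s)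

theorem SimpleGraph.IsClique.sum_le_wCliqueNum {s : Finset V} (hs : G.IsClique (s : Set V)) :
    ∑ v ∈ s, q v ≤ wCliqueNum G q :=
  le_csSup (bddAbove_cliqueWeights G q) ⟨s, hs, rfl⟩

theorem exists_isClique_sum_eq_wCliqueNum (G : SimpleGraph V) (q : V → ℕ) :
    ∃ s : Finset V, G.IsClique (s : Set V) ∧ (∀ v ∈ s, 0 < q v) ∧
      ∑ v ∈ s, q v = wCliqueNum G q := by
  obtain ⟨s, hs, h⟩ := Nat.sSup_mem
    (s := {m | ∃ s : Finset V, G.IsClique (s : Set V) ∧ m = ∑ v ∈ s, q v})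
    ⟨_, ∅, by simp, rfl⟩ (bddAbove_cliqueWeights G q)
  refine ⟨s.filter (0 < q ·), hs.subset (Finset.coe_subset.2 (Finset.filter_subset _ s)),
    by simp, ?_⟩
  refine Eq.trans ?_ h.symm
  exact Finset.sum_filter_of_ne fun v _ hv => Nat.pos_of_ne_zero hv

theorem wCliqueNum_pos {v : V} (hv : 0 < q v) : 0 < wCliqueNum G q :=
  hv.trans_le (by simpa using
    SimpleGraph.IsClique.sum_le_wCliqueNum (G := G) (q := q) (s := {v}) (by simp))

theorem wCliqueNum_mono {q' : V → ℕ} (h : ∀ v, q' v ≤ q v) :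
    wCliqueNum G q' ≤ wCliqueNum G q := by
  obtain ⟨s, hs, -, hsum⟩ := exists_isClique_sum_eq_wCliqueNum G q'
  rw [← hsum]
  exact (Finset.sum_le_sum fun v _ => h v).trans hs.sum_le_wCliqueNum

theorem wCliqueNum_merge_le [DecidableEq V] {u v : V} (huv : G.Adj u v)
    (htwin : ∀ w, 0 < q w → w ≠ u → w ≠ v → (G.Adj u w ↔ G.Adj v w)) :
    wCliqueNum G (Function.update (Function.update q v 0) u (q u + q v)) ≤ wCliqueNum G q := by
  obtain ⟨s, hs, hpos, hsum⟩ := exists_isClique_sum_eq_wCliqueNum G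
    (Function.update (Function.update q v 0) u (q u + q v))
  rw [← hsum]
  have hvs : v ∉ s := fun h => by simpa [huv.ne.symm] using hpos v h
  have hrest : ∀ w ∈ s, w ≠ u →
      Function.update (Function.update q v 0) u (q u + q v) w = q w := fun w hw hwu => by
    rw [Function.update_of_ne hwu, Function.update_of_ne (fun h : w = v => hvs (h ▸ hw))]
  by_cases hu : u ∈ s
  · have hclique : G.IsClique ((insert v s : Finset V) : Set V) := by
      rw [Finset.coe_insert]
      refine hs.insert fun w hw hne => ?_
      rcases eq_or_ne w u with rfl | hwu
      · exact huv.symm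
      · exact (htwin w (hrest w hw hwu ▸ hpos w hw) hwu hne.symm).1 (hs hu hw hwu.symm)
    refine le_trans (le_of_eq ?_) hclique.sum_le_wCliqueNum
    rw [Finset.sum_insert hvs, ← Finset.add_sum_erase s _ hu, ← Finset.add_sum_erase s q hu,
      Function.update_self, Finset.sum_congr rfl fun w hw =>
        hrest w (Finset.mem_of_mem_erase hw) (Finset.ne_of_mem_erase hw)]
    ring
  · refine le_trans (le_of_eq ?_) hs.sum_le_wCliqueNum
    exact Finset.sum_congr rfl fun w hw => hrest w hw fun h => hu (h ▸ hw)

theorem wCliqueNum_indicator_add_le {A B : Set V} (hdisj : Disjoint A B)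
    (hjoin : ∀ a ∈ A, 0 < q a → ∀ b ∈ B, 0 < q b → G.Adj a b) :
    wCliqueNum G (A.indicator q) + wCliqueNum G (B.indicator q) ≤ wCliqueNum G q := by
  classical
  have key : ∀ (C : Set V) (s : Finset V), (∀ v ∈ s, 0 < C.indicator q v) →
      (∀ v ∈ s, v ∈ C ∧ 0 < q v) ∧ ∑ v ∈ s, C.indicator q v = ∑ v ∈ s, q v := by
    intro C s hs
    have hC : ∀ v ∈ s, v ∈ C := fun v hv => by
      by_contra h
      simpa [Set.indicator_of_notMem h] using hs v hv
    have heq : ∀ v ∈ s, C.indicator q v = q v := fun v hv => Set.indicator_of_mem (hC v hv) q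
    exact ⟨fun v hv => ⟨hC v hv, heq v hv ▸ hs v hv⟩, Finset.sum_congr rfl heq⟩
  obtain ⟨s, hs, hspos, hssum⟩ := exists_isClique_sum_eq_wCliqueNum G (A.indicator q)
  obtain ⟨t, ht, htpos, htsum⟩ := exists_isClique_sum_eq_wCliqueNum G (B.indicator q)
  obtain ⟨hsA, hs'⟩ := key A s hspos
  obtain ⟨htB, ht'⟩ := key B t htpos
  have hst : Disjoint s t := Finset.disjoint_left.2 fun v hv hv' =>
    Set.disjoint_left.1 hdisj (hsA v hv).1 (htB v hv').1
  rw [← hssum, ← htsum, hs', ht', ← Finset.sum_union hst]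
  refine SimpleGraph.IsClique.sum_le_wCliqueNum ?_
  rw [Finset.coe_union]
  rintro a (ha | ha) b (hb | hb) hab
  · exact hs ha hb hab
  · exact hjoin a (hsA a ha).1 (hsA a ha).2 b (htB b hb).1 (htB b hb).2
  · exact (hjoin b (hsA b hb).1 (hsA b hb).2 a (htB a ha).1 (htB a ha).2).symm
  · exact ht ha hb hab

end CliqueNumber

section PathFour

variable {V : Type*}

/-- The vertices of `S` contain an induced path on four vertices. -/
def HasInducedP4 (G : SimpleGraph V) (S : Finset V) : Prop :=
  ∃ a ∈ S, ∃ b ∈ S, ∃ c ∈ S, ∃ d ∈ S, G.Adj a b ∧ G.Adj b c ∧ G.Adj c d ∧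
    ¬ G.Adj a c ∧ ¬ G.Adj b d ∧ ¬ G.Adj a d

theorem HasInducedP4.mono {G : SimpleGraph V} {S T : Finset V} (h : HasInducedP4 G S)
    (hST : S ⊆ T) : HasInducedP4 G T :=
  let ⟨a, ha, b, hb, c, hc, d, hd, h⟩ := h
  ⟨a, hST ha, b, hST hb, c, hST hc, d, hST hd, h⟩

theorem HasInducedP4.of_compl {G : SimpleGraph V} {S : Finset V} (h : HasInducedP4 Gᶜ S) :
    HasInducedP4 G S := by
  obtain ⟨a, ha, b, hb, c, hc, d, hd, hab, hbc, hcd, hac, hbd, had⟩ := h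
  simp only [SimpleGraph.compl_adj, not_and, not_not] at *
  have h1 : a ≠ c := by
    rintro rfl
    exact hcd.2 (had hcd.1)
  have h2 : b ≠ d := by
    rintro rfl
    exact hab.2 (had hab.1)
  have h3 : a ≠ d := by
    rintro rfl
    exact hcd.2 (hac h1).symm
  exact ⟨b, hb, d, hd, a, ha, c, hc, hbd h2, (had h3).symm, hac h1, fun h => hab.2 h.symm,
    fun h => hcd.2 h.symm, hbc.2⟩

/-- `P` splits `S` into two nonempty parts joined completely or not at all. -/
def IsSplit (G : SimpleGraph V) (S : Finset V) (P : V → Prop) : Prop :=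
  (∃ x ∈ S, P x) ∧ (∃ y ∈ S, ¬ P y) ∧
    ((∀ x ∈ S, ∀ y ∈ S, P x → ¬ P y → G.Adj x y) ∨
      (∀ x ∈ S, ∀ y ∈ S, P x → ¬ P y → ¬ G.Adj x y))

theorem IsSplit.of_compl {G : SimpleGraph V} {S : Finset V} {P : V → Prop}
    (h : IsSplit Gᶜ S P) : IsSplit G S P := by
  refine ⟨h.1, h.2.1, h.2.2.symm.imp ?_ ?_⟩
  · intro h x hx y hy hPx hPy
    have := h x hx y hy hPx hPy
    rw [SimpleGraph.compl_adj, not_and, not_not] at this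
    exact this fun hxy => hPy (hxy ▸ hPx)
  · exact fun h x hx y hy hPx hPy => (h x hx y hy hPx hPy).2

theorem exists_isSplit_insert [DecidableEq V] {G : SimpleGraph V} {S : Finset V} {v : V}
    {P : V → Prop} (hv : v ∉ S) (hP4 : ¬ HasInducedP4 G (insert v S))
    (hPos : ∃ x ∈ S, P x) (hNeg : ∃ y ∈ S, ¬ P y)
    (hP : ∀ x ∈ S, ∀ y ∈ S, P x → ¬ P y → ¬ G.Adj x y) :
    ∃ P', IsSplit G (insert v S) P' := by
  have hne : ∀ x ∈ S, x ≠ v := fun x hx h => hv (h ▸ hx)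
  obtain ⟨p, hpS, hp⟩ := hPos
  obtain ⟨n, hnS, hn⟩ := hNeg
  by_cases h1 : ∀ x ∈ S, P x → ¬ G.Adj v x
  · refine ⟨fun x => x ≠ v ∧ P x, ⟨p, by simp [hpS], hne p hpS, hp⟩, ⟨v, by simp, by simp⟩,
      .inr fun x hx y hy hx' hy' hadj => ?_⟩
    have hxS := (Finset.mem_insert.1 hx).resolve_left hx'.1
    rcases Finset.mem_insert.1 hy with rfl | hyS
    · exact h1 x hxS hx'.2 hadj.symm
    · exact hP x hxS y hyS hx'.2 (fun h => hy' ⟨hne y hyS, h⟩) hadj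
  by_cases h2 : ∀ x ∈ S, ¬ P x → ¬ G.Adj v x
  · refine ⟨fun x => ¬ (x ≠ v ∧ ¬ P x), ⟨v, by simp, by simp⟩,
      ⟨n, by simp [hnS], not_not.2 ⟨hne n hnS, hn⟩⟩, .inr fun x hx y hy hx' hy' hadj => ?_⟩
    rw [not_not] at hy'
    have hyS := (Finset.mem_insert.1 hy).resolve_left hy'.1
    rcases Finset.mem_insert.1 hx with rfl | hxS
    · exact h2 y hyS hy'.2 hadj
    · exact hP x hxS y hyS (by_contra fun h => hx' ⟨hne x hxS, h⟩) hy'.2 hadj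
  push Not at h1 h2
  obtain ⟨x₁, hx₁S, hx₁, hvx₁⟩ := h1
  obtain ⟨x₂, hx₂S, hx₂, hvx₂⟩ := h2
  by_cases h3 : ∀ x ∈ S, G.Adj v x
  · refine ⟨fun x => x = v, ⟨v, by simp, rfl⟩, ⟨p, by simp [hpS], hne p hpS⟩,
      .inl fun x hx y hy hx' hy' => ?_⟩
    subst hx'
    exact h3 y ((Finset.mem_insert.1 hy).resolve_left hy')
  push Not at h3
  obtain ⟨z, hzS, hvz⟩ := h3
  refine ⟨fun x => x ≠ v ∧ ¬ G.Adj v x, ⟨z, by simp [hzS], hne z hzS, hvz⟩,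
    ⟨v, by simp, by simp⟩, .inr fun x hx y hy hx' hy' hadj => ?_⟩
  have hxS := (Finset.mem_insert.1 hx).resolve_left hx'.1
  rcases Finset.mem_insert.1 hy with rfl | hyS
  · exact hx'.2 hadj.symm
  have hvy : G.Adj v y := by_contra fun h => hy' ⟨hne y hyS, h⟩
  have hmem : ∀ w ∈ S, w ∈ insert v S := fun w hw => Finset.mem_insert_of_mem hw
  by_cases hPx : P x
  · have hPy : P y := by_contra fun h => hP x hxS y hyS hPx h hadj
    exact hP4 ⟨x, hmem x hxS, y, hmem y hyS, v, by simp, x₂, hmem x₂ hx₂S, hadj, hvy.symm, hvx₂,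
      fun h => hx'.2 h.symm, hP y hyS x₂ hx₂S hPy hx₂, hP x hxS x₂ hx₂S hPx hx₂⟩
  · have hPy : ¬ P y := fun h => hP y hyS x hxS h hPx hadj.symm
    exact hP4 ⟨x, hmem x hxS, y, hmem y hyS, v, by simp, x₁, hmem x₁ hx₁S, hadj, hvy.symm, hvx₁,
      fun h => hx'.2 h.symm, fun h => hP x₁ hx₁S y hyS hx₁ hPy h.symm,
      fun h => hP x₁ hx₁S x hxS hx₁ hPx h.symm⟩

/-- Seinsche's theorem: a `P₄`-free graph on at least two vertices is disconnected or
co-disconnected. -/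
theorem exists_isSplit {G : SimpleGraph V} {S : Finset V} (hS : 2 ≤ S.card)
    (hP4 : ¬ HasInducedP4 G S) : ∃ P, IsSplit G S P := by
  classical
  induction S using Finset.induction_on with
  | empty => simp at hS
  | insert v S hv ih =>
    rw [Finset.card_insert_of_notMem hv] at hS
    rcases (show S.card = 1 ∨ 2 ≤ S.card by omega) with h1 | h2
    · obtain ⟨w, rfl⟩ := Finset.card_eq_one.1 h1
      have hwv : w ≠ v := fun h => hv (by simp [h])
      refine ⟨fun x => x = v, ⟨v, by simp, rfl⟩, ⟨w, by simp, hwv⟩, ?_⟩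
      by_cases hadj : G.Adj v w
      · left
        rintro x - y hy rfl hyx
        simpa [(by simpa [hyx] using hy : y = w)] using hadj
      · right
        rintro x - y hy rfl hyx
        simpa [(by simpa [hyx] using hy : y = w)] using hadj
    · obtain ⟨P, hpos, hneg, hjoin | hempty⟩ :=
        ih h2 fun h => hP4 (h.mono (Finset.subset_insert v S))
      · obtain ⟨P', hP'⟩ := exists_isSplit_insert (G := Gᶜ) hv (fun h => hP4 h.of_compl) hpos hneg
          fun x hx y hy hPx hPy h => h.2 (hjoin x hx y hy hPx hPy)
        exact ⟨P', hP'.of_compl⟩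
      · exact exists_isSplit_insert hv hP4 hpos hneg hempty

/-- A `P₄`-free graph on at least two vertices has a pair of twins. -/
theorem exists_twins_of_not_hasInducedP4 {G : SimpleGraph V} {S : Finset V} (hS : 2 ≤ S.card)
    (hP4 : ¬ HasInducedP4 G S) :
    ∃ u ∈ S, ∃ v ∈ S, u ≠ v ∧ ∀ w ∈ S, w ≠ u → w ≠ v → (G.Adj u w ↔ G.Adj v w) := by
  classical
  induction S using Finset.strongInduction with
  | H S ih =>
    obtain ⟨P, ⟨p, hpS, hp⟩, ⟨n, hnS, hn⟩, hsplit⟩ := exists_isSplit hS hP4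
    have hcross : ∀ x ∈ S, ∀ y ∈ S, ∀ w ∈ S, (P x ↔ P y) → ¬ (P x ↔ P w) →
        (G.Adj x w ↔ G.Adj y w) := by
      intro x hx y hy w hw hxy hxw
      rcases hsplit with h | h
      · by_cases hPx : P x
        · exact iff_of_true (h x hx w hw hPx (by tauto)) (h y hy w hw (by tauto) (by tauto))
        · exact iff_of_true (h w hw x hx (by tauto) hPx).symm
            (h w hw y hy (by tauto) (by tauto)).symm
      · by_cases hPx : P x
        · exact iff_of_false (h x hx w hw hPx (by tauto)) (h y hy w hw (by tauto) (by tauto))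
        · exact iff_of_false (fun h' => h w hw x hx (by tauto) hPx h'.symm)
            (fun h' => h w hw y hy (by tauto) (by tauto) h'.symm)
    have hpart : ∀ T ⊂ S, (∀ x ∈ T, ∀ w ∈ S, w ∈ T ↔ (P x ↔ P w)) → 2 ≤ T.card →
        ∃ u ∈ S, ∃ v ∈ S, u ≠ v ∧ ∀ w ∈ S, w ≠ u → w ≠ v → (G.Adj u w ↔ G.Adj v w) := by
      intro T hTS hT hT2
      obtain ⟨u, hu, v, hv, huv, h⟩ := ih T hTS hT2 fun h => hP4 (h.mono hTS.1)
      refine ⟨u, hTS.1 hu, v, hTS.1 hv, huv, fun w hw hwu hwv => ?_⟩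
      by_cases hwT : w ∈ T
      · exact h w hwT hwu hwv
      · exact hcross u (hTS.1 hu) v (hTS.1 hv) w hw ((hT u hu v (hTS.1 hv)).1 hv)
          fun h => hwT ((hT u hu w hw).2 h)
    by_cases h1 : 2 ≤ (S.filter P).card
    · refine hpart _ (Finset.filter_ssubset.2 ⟨n, hnS, hn⟩) ?_ h1
      simp only [Finset.mem_filter]
      tauto
    by_cases h2 : 2 ≤ (S.filter (¬ P ·)).card
    · refine hpart _ (Finset.filter_ssubset.2 ⟨p, hpS, not_not.2 hp⟩) ?_ h2
      simp only [Finset.mem_filter]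
      tauto
    have e1 := Finset.card_le_one.1 (show (S.filter P).card ≤ 1 by omega)
    have e2 := Finset.card_le_one.1 (show (S.filter (¬ P ·)).card ≤ 1 by omega)
    simp only [Finset.mem_filter] at e1 e2
    refine ⟨p, hpS, n, hnS, fun h => hn (h ▸ hp), fun w hw hwp hwn => ?_⟩
    by_cases hPw : P w
    · exact absurd (e1 w ⟨hw, hPw⟩ p ⟨hpS, hp⟩) hwp
    · exact absurd (e2 w ⟨hw, hPw⟩ n ⟨hnS, hn⟩) hwn

/-- In a `Q(P₄)`-free graph, nonadjacent vertices that are complete to a set containing an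
induced `P₄` have the same neighbours among the vertices anticomplete to that set. -/
theorem IndFree.adj_of_hasInducedP4 {G : SimpleGraph V}
    (hfree : IndFree (QGraph (pathGraph 4)) G) {S : Finset V} (hP4 : HasInducedP4 G S)
    {u v w : V} (hu : ∀ x ∈ S, G.Adj u x) (hv : ∀ x ∈ S, G.Adj v x)
    (hw : ∀ x ∈ S, ¬ G.Adj w x) (huv : ¬ G.Adj u v) (huw : G.Adj u w) : G.Adj v w := by
  by_contra hvw
  obtain ⟨a, ha, b, hb, c, hc, d, hd, hab, hbc, hcd, hac, hbd, had⟩ := hP4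
  let φ : Fin 4 ⊕ Fin 3 → V := Sum.elim ![a, b, c, d] ![w, u, v]
  have hadj : ∀ x y, G.Adj (φ x) (φ y) ↔ (QGraph (pathGraph 4)).Adj x y := by
    have hua := hu a ha
    have hub := hu b hb
    have huc := hu c hc
    have hud := hu d hd
    have hva := hv a ha
    have hvb := hv b hb
    have hvc := hv c hc
    have hvd := hv d hd
    have hwa := hw a ha
    have hwb := hw b hb
    have hwc := hw c hc
    have hwd := hw d hd
    rintro (x | x) (y | y) <;> fin_cases x <;> fin_cases y <;>
      simp [φ, QGraph, pathGraph_adj, *, G.adj_comm]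
  have hinj : Function.Injective φ := by
    have hac' : a ≠ c := by rintro rfl; exact had hcd
    have hbd' : b ≠ d := by rintro rfl; exact had hab
    have had' : a ≠ d := by rintro rfl; exact hac hcd.symm
    have hwu : w ≠ u := huw.ne.symm
    have hwv : w ≠ v := by rintro rfl; exact hw a ha (hv a ha)
    have huv' : u ≠ v := by rintro rfl; exact hvw huw
    have hwS : ∀ x ∈ S, x ≠ w := by
      rintro x hx rfl
      exact hvw (hv x hx)
    have huS : ∀ x ∈ S, x ≠ u := fun x hx => (hu x hx).ne.symm
    have hvS : ∀ x ∈ S, x ≠ v := fun x hx => (hv x hx).ne.symm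
    refine Function.Injective.sumElim ?_ ?_ ?_
    · intro i j
      fin_cases i <;> fin_cases j <;>
        simp [hab.ne, hab.ne.symm, hbc.ne, hbc.ne.symm, hcd.ne, hcd.ne.symm, hac', hac'.symm,
          hbd', hbd'.symm, had', had'.symm]
    · intro i j
      fin_cases i <;> fin_cases j <;> simp [hwu, hwu.symm, hwv, hwv.symm, huv', huv'.symm]
    · intro i j
      fin_cases i <;> fin_cases j <;> simp [*]
  let e : QGraph (pathGraph 4) ↪g G := ⟨⟨φ, hinj⟩, hadj _ _⟩
  exact hfree (Set.range e) ⟨e.isoInduceRange⟩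

/-- The vertices complete to a set containing an induced `P₄` can be labelled so that vertices
with distinct labels are adjacent, while vertices with a common label have the same neighbours
among the vertices anticomplete to that set. -/
theorem IndFree.exists_label.{u} {V : Type u} {G : SimpleGraph V}
    (hfree : IndFree (QGraph (pathGraph 4)) G) {S : Finset V} (hP4 : HasInducedP4 G S)
    {N : Set V} (hN : ∀ u ∈ N, ∀ x ∈ S, G.Adj u x) :
    ∃ (ι : Type u) (c : V → ι), (∀ u ∈ N, ∀ v ∈ N, c u ≠ c v → G.Adj u v) ∧
      ∀ u ∈ N, ∀ v ∈ N, c u = c v → ∀ w, (∀ x ∈ S, ¬ G.Adj w x) → (G.Adj u w ↔ G.Adj v w) := by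
  let H : SimpleGraph V := SimpleGraph.fromRel fun u v => u ∈ N ∧ v ∈ N ∧ ¬ G.Adj u v
  refine ⟨_, H.connectedComponentMk, fun u hu v hv hne => ?_, fun u hu v hv h w hw => ?_⟩
  · by_contra hadj
    refine hne (SimpleGraph.ConnectedComponent.sound (SimpleGraph.Adj.reachable ?_))
    exact (SimpleGraph.fromRel_adj _ _ _).2 ⟨fun h => hne (h ▸ rfl), .inl ⟨hu, hv, hadj⟩⟩
  · obtain ⟨p⟩ := SimpleGraph.ConnectedComponent.exact h
    clear h
    induction p with
    | nil => rfl
    | @cons a b _ hab _ ih =>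
      have key : a ∈ N ∧ b ∈ N ∧ ¬ G.Adj a b := by
        rcases ((SimpleGraph.fromRel_adj _ _ _).1 hab).2 with h | ⟨h1, h2, h3⟩
        · exact h
        · exact ⟨h2, h1, fun h => h3 h.symm⟩
      obtain ⟨-, hb, hnadj⟩ := key
      refine Iff.trans ⟨?_, ?_⟩ (ih hb hv)
      · exact hfree.adj_of_hasInducedP4 hP4 (hN a hu) (hN b hb) hw hnadj
      · exact hfree.adj_of_hasInducedP4 hP4 (hN b hb) (hN a hu) hw fun h => hnadj h.symm

end PathFour

/-- If `G` is a finite `Q(P₄)`-free graph, `q` a vertex-weight function positive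
somewhere, and `f` a superadditive function such that `χ_{q'}(G) ≤ f(ω_{q'}(G))` for
every `⊲`-minimal weight function `q'` (positive somewhere) for which `G[q']` is prime
and has no clique-separator of modules, then `χ_q(G) ≤ f(ω_q(G))`. -/
theorem stmt19 {V : Type} [Fintype V] (G : SimpleGraph V)
    (hfree : IndFree (QGraph (pathGraph 4)) G)
    (q : V → ℕ) (hq : ∃ v, 0 < q v)
    (f : ℕ → ℕ) (hfpos : ∀ s, 0 < s → 0 < f s)
    (hsuper : ∀ s₁ s₂, 0 < s₁ → 0 < s₂ → f s₁ + f s₂ ≤ f (s₁ + s₂))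
    (hyp : ∀ q' : V → ℕ, (∃ v, 0 < q' v) → IsTriMinimal G q' →
      IsPrime (G.induce {v | 0 < q' v}) →
      (∀ X : Set ↥{v : V | 0 < q' v},
        ¬ IsCliqueSeparatorOfModules (G.induce {v | 0 < q' v}) X) →
      wChromaticNumber G q' ≤ f (wCliqueNum G q')) :
    wChromaticNumber G q ≤ f (wCliqueNum G q) := by
  classical
  have hmono : ∀ a b, 0 < a → a ≤ b → f a ≤ f b := by
    intro a b ha hab
    rcases hab.eq_or_lt with rfl | hlt
    · exact le_rfl
    · have := hsuper a (b - a) ha (by omega)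
      rw [Nat.add_sub_cancel' hab] at this
      omega
  induction hn : (∑ v, q v) + (Finset.univ.filter (0 < q ·)).card
    using Nat.strong_induction_on generalizing q with
  | _ n ih =>
  subst hn
  have ih_self : ∀ q' : V → ℕ, (∀ v, q' v ≤ q v) → (∃ v, q' v < q v) → (∃ v, 0 < q' v) →
      wChromaticNumber G q' ≤ f (wCliqueNum G q') := by
    rintro q' hle ⟨v, hv⟩ hpos
    refine ih _ (add_lt_add_of_lt_of_le
      (Finset.sum_lt_sum (fun v _ => hle v) ⟨v, Finset.mem_univ v, hv⟩)
      (Finset.card_le_card ?_)) q' hpos rfl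
    exact Finset.monotone_filter_right _ fun v _ h => lt_of_lt_of_le h (hle v)
  have ih_lt : ∀ q' : V → ℕ, (∀ v, q' v ≤ q v) → (∃ v, q' v < q v) → (∃ v, 0 < q' v) →
      wChromaticNumber G q' ≤ f (wCliqueNum G q) := fun q' hle hlt hpos =>
    (ih_self q' hle hlt hpos).trans
      (hmono _ _ (wCliqueNum_pos hpos.choose_spec) (wCliqueNum_mono hle))
  have ind_le : ∀ (C : Set V) v, C.indicator q v ≤ q v :=
    fun C v => Set.indicator_le_self' (fun _ _ => Nat.zero_le _) v
  have of_separator : ∀ {ι : Type} {A B : Set V} {c : V → ι},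
      (∀ v, 0 < q v → v ∈ A ∪ B) → (∃ v ∈ A \ B, 0 < q v) → (∃ v ∈ B \ A, 0 < q v) →
      (∀ a ∈ A \ B, ∀ b ∈ B \ A, ¬ G.Adj a b) →
      (∀ u ∈ A ∩ B, ∀ v ∈ A ∩ B, c u ≠ c v → G.Adj u v) →
      (∀ u ∈ A ∩ B, ∀ v ∈ A ∩ B, c u = c v → ∀ w, 0 < q w → w ∉ A ∩ B →
        (G.Adj u w ↔ G.Adj v w)) →
      wChromaticNumber G q ≤ f (wCliqueNum G q) := by
    rintro ι A B c hcover ⟨a, ha, hqa⟩ ⟨b, hb, hqb⟩ hsep hjoin hmod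
    refine (wChromaticNumber_le_max_of_separator hcover hsep hjoin hmod).trans (max_le ?_ ?_)
    · exact ih_lt _ (ind_le A) ⟨b, by rwa [Set.indicator_of_notMem hb.2]⟩
        ⟨a, by rwa [Set.indicator_of_mem ha.1]⟩
    · exact ih_lt _ (ind_le B) ⟨a, by rwa [Set.indicator_of_notMem ha.2]⟩
        ⟨b, by rwa [Set.indicator_of_mem hb.1]⟩
  have of_twins : ∀ u v, u ≠ v → 0 < q u → 0 < q v →
      (∀ w, 0 < q w → w ≠ u → w ≠ v → (G.Adj u w ↔ G.Adj v w)) →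
      wChromaticNumber G q ≤ f (wCliqueNum G q) := by
    have of_nonadj : ∀ u v, u ≠ v → 0 < q u → 0 < q v → ¬ G.Adj u v → q v ≤ q u →
        (∀ w, 0 < q w → w ≠ u → w ≠ v → (G.Adj u w ↔ G.Adj v w)) →
        wChromaticNumber G q ≤ f (wCliqueNum G q) := by
      intro u v hne hu hv hadj hle htwin
      refine (wChromaticNumber_le_update_zero hadj hle hne htwin).trans
        (ih_lt _ (fun w => ?_) ⟨v, by simpa using hv⟩ ⟨u, by rwa [Function.update_of_ne hne]⟩)
      rcases eq_or_ne w v with rfl | hw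
      · simp
      · rw [Function.update_of_ne hw]
    intro u v hne hu hv htwin
    by_cases hadj : G.Adj u v
    · have hpos : 0 < Function.update (Function.update q v 0) u (q u + q v) u := by
        rw [Function.update_self]
        omega
      refine (wChromaticNumber_le_merge hne htwin).trans <|
        (ih _ (add_lt_add_of_le_of_lt (le_of_eq ?_) (Finset.card_lt_card ?_)) _ ⟨u, hpos⟩
          rfl).trans (hmono _ _ (wCliqueNum_pos hpos) (wCliqueNum_merge_le hadj htwin))
      · have hv' : v ∈ Finset.univ.erase u := by simp [hne.symm]
        rw [← Finset.add_sum_erase _ _ (Finset.mem_univ u), ← Finset.add_sum_erase _ _ hv',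
          ← Finset.add_sum_erase _ q (Finset.mem_univ u), ← Finset.add_sum_erase _ q hv',
          Function.update_self, Function.update_of_ne hne.symm, Function.update_self,
          Finset.sum_congr rfl fun w hw => ?_]
        · rw [zero_add, add_assoc]
        · simp only [Finset.mem_erase] at hw
          rw [Function.update_of_ne hw.2.1, Function.update_of_ne hw.1]
      · refine Finset.ssubset_iff_subset_ne.2 ⟨fun w hw => ?_, fun h => ?_⟩
        · rw [Finset.mem_filter_univ] at hw ⊢
          by_cases hwu : w = u
          · rwa [hwu]
          · by_cases hwv : w = v
            · rwa [hwv]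
            · rwa [Function.update_of_ne hwu, Function.update_of_ne hwv] at hw
        · have hmem := (Finset.mem_filter_univ (p := (0 < q ·)) v).2 hv
          rw [← h, Finset.mem_filter_univ, Function.update_of_ne hne.symm,
            Function.update_self] at hmem
          exact hmem.false
    · rcases le_total (q v) (q u) with hle | hle
      · exact of_nonadj u v hne hu hv hadj hle htwin
      · exact of_nonadj v u hne.symm hv hu (fun h => hadj h.symm) hle
          fun w hw hwv hwu => (htwin w hw hwu hwv).symm
  by_contra hcon
  refine hcon (hyp q hq ?_ ?_ ?_)
  · rintro ⟨q', hle, hlt, heq⟩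
    by_cases hpos : ∃ v, 0 < q' v
    · obtain ⟨v, -, hv⟩ := Finset.exists_lt_of_sum_lt hlt
      exact hcon (heq ▸ ih_lt q' hle ⟨v, hv⟩ hpos)
    · push Not at hpos
      have hcol : IsWeightedColoring G q' fun _ => (∅ : Finset (Fin 0)) :=
        ⟨fun v => by simpa using (Nat.le_zero.1 (hpos v)).symm, fun _ _ _ => by simp⟩
      have := wChromaticNumber_le_card hcol
      rw [heq, Fintype.card_fin] at this
      exact hcon (this.trans (Nat.zero_le _))
  · rintro ⟨M', hM', hcard, hcard'⟩
    let M : Finset V := Finset.univ.filter fun v => ∃ h : 0 < q v, (⟨v, h⟩ : {v | 0 < q v}) ∈ M'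
    have hM : ∀ v, v ∈ M ↔ ∃ h : 0 < q v, (⟨v, h⟩ : {v | 0 < q v}) ∈ M' := by simp [M]
    have hMpos : ∀ v ∈ M, 0 < q v := fun v hv => ((hM v).1 hv).1
    have hmod : ∀ w, 0 < q w → w ∉ M → (∀ x ∈ M, G.Adj w x) ∨ ∀ x ∈ M, ¬ G.Adj w x := by
      intro w hw hwM
      refine (hM'.2 ⟨w, hw⟩ fun h => hwM ((hM w).2 ⟨hw, h⟩)).imp ?_ ?_
      all_goals
        intro h x hx
        obtain ⟨hx, hxM⟩ := (hM x).1 hx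
        exact h _ hxM
    have htwo : 2 ≤ M.card := by
      obtain ⟨a, ha, b, hb, hab⟩ := (Set.one_lt_ncard (Set.toFinite M')).1 hcard
      exact Finset.one_lt_card.2 ⟨a, (hM a).2 ⟨a.2, ha⟩, b, (hM b).2 ⟨b.2, hb⟩,
        fun h => hab (Subtype.ext h)⟩
    obtain ⟨z, hz, hzM⟩ : ∃ z, 0 < q z ∧ z ∉ M := by
      by_contra! h
      have : M' = Set.univ := Set.eq_univ_of_forall fun x => ((hM x).1 (h x x.2)).2
      rw [this, Set.ncard_univ] at hcard'
      exact hcard'.false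
    obtain ⟨m, hm⟩ : M.Nonempty := Finset.card_pos.1 (by omega)
    by_cases hP4 : HasInducedP4 G M
    · let N : Set V := {w | 0 < q w ∧ w ∉ M ∧ ∀ x ∈ M, G.Adj w x}
      by_cases hA : ∃ w, 0 < q w ∧ w ∉ M ∧ ∀ x ∈ M, ¬ G.Adj w x
      · let A : Set V := {w | 0 < q w ∧ w ∉ M ∧ ∀ x ∈ M, ¬ G.Adj w x}
        have hAN : ∀ w ∈ A, w ∉ N := fun w hw hw' => hw.2.2 m hm (hw'.2.2 m hm)
        have hinter : (↑M ∪ N) ∩ (N ∪ A) = N := by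
          ext w
          refine ⟨?_, fun h => ⟨.inr h, .inl h⟩⟩
          rintro ⟨h1, h2 | h2⟩
          · exact h2
          · exact h1.resolve_left h2.2.1
        obtain ⟨ι, c, hjoin, hlabel⟩ := hfree.exists_label hP4 (N := N) fun u hu => hu.2.2
        obtain ⟨a, ha⟩ := hA
        have haA : a ∈ A := ha
        refine hcon (of_separator (A := ↑M ∪ N) (B := N ∪ A) (c := c) (fun v hv => ?_)
          ⟨m, ⟨.inl hm, ?_⟩, hMpos m hm⟩ ⟨a, ⟨.inr haA, ?_⟩, ha.1⟩ ?_ ?_ ?_)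
        · by_cases hvM : v ∈ M
          · exact .inl (.inl hvM)
          · exact (hmod v hv hvM).elim (fun h => .inl (.inr ⟨hv, hvM, h⟩))
              fun h => .inr (.inr ⟨hv, hvM, h⟩)
        · rintro (h | h)
          · exact h.2.1 hm
          · exact h.2.1 hm
        · rintro (h | h)
          · exact ha.2.1 h
          · exact hAN a haA h
        · rintro x ⟨hx | hx, hx'⟩ y ⟨hy | hy, hy'⟩
          · exact absurd (.inr hy) hy'
          · exact fun h => hy.2.2 x hx h.symm
          · exact absurd (.inl hx) hx'
          · exact absurd (.inl hx) hx'
        · rwa [hinter]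
        · rw [hinter]
          intro u hu v hv huv w hw hwN
          by_cases hwM : w ∈ M
          · exact iff_of_true (hu.2.2 w hwM) (hv.2.2 w hwM)
          · exact hlabel u hu v hv huv w
              ((hmod w hw hwM).resolve_left fun h => hwN ⟨hw, hwM, h⟩)
      · have hN : ∀ w, 0 < q w → w ∉ M → w ∈ N := fun w hw hwM =>
          ⟨hw, hwM, (hmod w hw hwM).resolve_right fun h => hA ⟨w, hw, hwM, h⟩⟩
        have hmM : 0 < (↑M : Set V).indicator q m := by
          rw [Set.indicator_of_mem (by exact hm)]
          exact hMpos m hm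
        have hzN : 0 < N.indicator q z := by rwa [Set.indicator_of_mem (hN z hz hzM)]
        have ih_ind : ∀ C : Set V, (∃ v ∉ C, 0 < q v) → (∃ v, 0 < C.indicator q v) →
            wChromaticNumber G (C.indicator q) ≤ f (wCliqueNum G (C.indicator q)) := by
          rintro C ⟨v, hvC, hv⟩ hpos
          exact ih_self _ (ind_le C) ⟨v, by rwa [Set.indicator_of_notMem hvC]⟩ hpos
        have hjoin := wCliqueNum_indicator_add_le (G := G) (q := q) (A := ↑M) (B := N)
          (Set.disjoint_left.2 fun x hx hx' => hx'.2.1 hx)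
          fun x hx _ y hy _ => (hy.2.2 x hx).symm
        have hωM := wCliqueNum_pos (G := G) hmM
        have hωN := wCliqueNum_pos (G := G) hzN
        refine hcon ((wChromaticNumber_le_add (A := ↑M) (B := N) fun v hv => ?_).trans <|
          (add_le_add (ih_ind _ ⟨z, hzM, hz⟩ ⟨m, hmM⟩)
            (ih_ind _ ⟨m, fun h => h.2.1 hm, hMpos m hm⟩ ⟨z, hzN⟩)).trans <|
          (hsuper _ _ hωM hωN).trans (hmono _ _ (by omega) hjoin))
        by_cases hvM : v ∈ M
        · exact .inl hvM
        · exact .inr (hN v hv hvM)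
    · obtain ⟨u, hu, v, hv, huv, htwin⟩ := exists_twins_of_not_hasInducedP4 htwo hP4
      refine hcon (of_twins u v huv (hMpos u hu) (hMpos v hv) fun w hw hwu hwv => ?_)
      by_cases hwM : w ∈ M
      · exact htwin w hwM hwu hwv
      · rcases hmod w hw hwM with h | h
        · exact iff_of_true (h u hu).symm (h v hv).symm
        · exact iff_of_false (fun h' => h u hu h'.symm) fun h' => h v hv h'.symm
  · rintro X ⟨⟨k, Xs, hmodule, hdisj, hjoin, hX⟩, A, B, hcover, ⟨a, ha⟩, ⟨b, hb⟩, hsep, hAB⟩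
    have hval : ∀ (C : Set {v | 0 < q v}) (x : {v | 0 < q v}), (x : V) ∈ Subtype.val '' C ↔ x ∈ C :=
      fun C x => Subtype.val_injective.mem_set_image
    have hinter : Subtype.val '' A ∩ Subtype.val '' B = Subtype.val '' X := by
      rw [← Set.image_inter Subtype.val_injective, hAB]
    have hclass : ∀ x ∈ X, ∃ i, x ∈ Xs i ∧ {j | x ∈ Xs j} = {i} := by
      intro x hx
      rw [hX, Set.mem_iUnion] at hx
      obtain ⟨i, hi⟩ := hx
      refine ⟨i, hi, Set.eq_singleton_iff_unique_mem.2 ⟨hi, fun j hj => ?_⟩⟩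
      by_contra hne
      exact Set.disjoint_left.1 (hdisj j i hne) hj hi
    refine hcon (of_separator (A := Subtype.val '' A) (B := Subtype.val '' B)
      (c := fun v => {i | v ∈ Subtype.val '' Xs i}) (fun v hv => ?_)
      ⟨a, ⟨(hval A a).2 ha.1, fun h => ha.2 ((hval B a).1 h)⟩, a.2⟩
      ⟨b, ⟨(hval B b).2 hb.1, fun h => hb.2 ((hval A b).1 h)⟩, b.2⟩ ?_ ?_ ?_)
    · rw [← Set.image_union, hcover]
      exact ⟨⟨v, hv⟩, trivial, rfl⟩
    · rintro _ ⟨⟨x, hx, rfl⟩, hx'⟩ _ ⟨⟨y, hy, rfl⟩, hy'⟩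
      rw [hval] at hx' hy'
      exact hsep x ⟨hx, hx'⟩ y ⟨hy, hy'⟩
    · rw [hinter]
      rintro _ ⟨x, hx, rfl⟩ _ ⟨y, hy, rfl⟩ hne
      obtain ⟨i, hi, hxi⟩ := hclass x hx
      obtain ⟨j, hj, hyj⟩ := hclass y hy
      simp only [hval, hxi, hyj] at hne
      exact hjoin i j (fun h => hne (h ▸ rfl)) x hi y hj
    · rw [hinter]
      rintro _ ⟨x, hx, rfl⟩ _ ⟨y, hy, rfl⟩ heq w hw hwX
      obtain ⟨i, hi, hxi⟩ := hclass x hx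
      obtain ⟨j, hj, hyj⟩ := hclass y hy
      simp only [hval, hxi, hyj, Set.singleton_eq_singleton_iff] at heq
      subst heq
      have hwi : (⟨w, hw⟩ : {v | 0 < q v}) ∉ Xs i := fun h =>
        hwX ⟨⟨w, hw⟩, hX ▸ Set.mem_iUnion.2 ⟨i, h⟩, rfl⟩
      rcases (hmodule i).2 _ hwi with h | h
      · exact iff_of_true (h x hi).symm (h y hj).symm
      · exact iff_of_false (fun h' => h x hi h'.symm) fun h' => h y hj h'.symm
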